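/- For all positive integers k, m and all reals L > 0 and κ > 0, there exist c > 0 and L' ≥ 1, depending only on k, m, L and κ, such that the following holds: for every subset A ⊆ [0,1]^k and every L-Lipschitz map F : A → ℝ^m whose image F(A) has Hausdorff k-content at least κ, there exists B ⊆ A with H^k(B) ≥ c such that F is biLipschitz with constant L' on B. -/

import Mathlib

open MeasureTheory Metric Set Filter
open scoped ENNReal NNReal

noncomputable section

/-- The closed unit cube `[0,1]^n` in `ℝ^n` with the Euclidean metric. -/
def unitCube (n : ℕ) : Set (EuclideanSpace ℝ (Fin n)) :=
  {x | ∀ i, x i ∈ Set.Icc (0:ℝ) 1}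

/-- Hausdorff `d`-content: the infimum over countable covers `{U i}` of `S`
of `∑ i, (diam (U i))^d`. -/
def hContent {X : Type*} [PseudoEMetricSpace X] (d : ℝ) (S : Set X) : ℝ≥0∞ :=
  ⨅ (U : ℕ → Set X) (_ : S ⊆ ⋃ i, U i), ∑' i, EMetric.diam (U i) ^ d

/-- `F` is biLipschitz with constant `L` on `S`. -/
def BiLipschitzWithOn {X Y : Type*} [PseudoMetricSpace X] [PseudoMetricSpace Y]
    (L : ℝ) (F : X → Y) (S : Set X) : Prop :=
  ∀ x ∈ S, ∀ y ∈ S, L⁻¹ * dist x y ≤ dist (F x) (F y) ∧ dist (F x) (F y) ≤ L * dist x y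

/-- `F` is biLipschitz on `S`: for some `L ≥ 1`,
`L⁻¹ · dist x y ≤ dist (F x) (F y) ≤ L · dist x y` on `S`. -/
def BiLipschitzOn {X Y : Type*} [PseudoMetricSpace X] [PseudoMetricSpace Y]
    (F : X → Y) (S : Set X) : Prop :=
  ∃ L : ℝ, 1 ≤ L ∧ BiLipschitzWithOn L F S


theorem enorm_add_sq_add_enorm_sub_sq {E' : Type*} [NormedAddCommGroup E']
    [InnerProductSpace ℝ E'] (a b : E') :
    ‖a + b‖ₑ ^ 2 + ‖a - b‖ₑ ^ 2 = 2 * ‖a‖ₑ ^ 2 + 2 * ‖b‖ₑ ^ 2 := by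
  have h := parallelogram_law_with_norm ℝ a b
  simp only [← ofReal_norm, ← ENNReal.ofReal_pow (norm_nonneg _)]
  rw [← ENNReal.ofReal_add (by positivity) (by positivity), h, mul_add,
    ENNReal.ofReal_add (by positivity) (by positivity), ENNReal.ofReal_mul (by norm_num),
    ENNReal.ofReal_mul (by norm_num)]
  simp

theorem enorm_sub_sq_le {E' : Type*} [NormedAddCommGroup E'] [InnerProductSpace ℝ E'] (a b : E') :
    ‖a - b‖ₑ ^ 2 ≤ 2 * ‖a‖ₑ ^ 2 + 2 * ‖b‖ₑ ^ 2 := by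
  rw [← enorm_add_sq_add_enorm_sub_sq]
  exact le_add_self

theorem measurable_enorm_sq_of_continuous {X E' : Type*} [TopologicalSpace X]
    [MeasurableSpace X] [OpensMeasurableSpace X] [NormedAddCommGroup E'] {f : X → E'} (hf : Continuous f) :
    Measurable fun x => ‖f x‖ₑ ^ 2 :=
  (by fun_prop : Continuous fun x => ‖f x‖ₑ ^ 2).measurable

section Energy

variable {E E' : Type*} [NormedAddCommGroup E] [MeasurableSpace E] [BorelSpace E]
  [NormedAddCommGroup E']

/-- The energy of the first differences of `F` with step `h`. -/
def diffEnergy (μ : Measure E) (F : E → E') (h : E) : ℝ≥0∞ :=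
  ∫⁻ x, ‖F (x + h) - F x‖ₑ ^ 2 ∂μ

/-- The energy of the second differences of `F` with step `h`. -/
def secondDiffEnergy (μ : Measure E) (F : E → E') (h : E) : ℝ≥0∞ :=
  ∫⁻ x, ‖F (x + h + h) - F (x + h) - (F (x + h) - F x)‖ₑ ^ 2 ∂μ

theorem diffEnergy_le (μ : Measure E) {F : E → E'} {L P : ℝ}
    (hF : ∀ x y, ‖F x - F y‖ ≤ L * ‖x - y‖) (hsupp : ∀ x, P < ‖x‖ → F x = 0) (h : E) :
    diffEnergy μ F h ≤
      ENNReal.ofReal ((L * ‖h‖) ^ 2) * μ (closedBall 0 (P + ‖h‖)) := by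
  rw [← lintegral_indicator_const measurableSet_closedBall]
  refine lintegral_mono fun x => ?_
  by_cases hx : x ∈ closedBall (0 : E) (P + ‖h‖)
  · rw [indicator_of_mem hx, ← ofReal_norm, ← ENNReal.ofReal_pow (norm_nonneg _)]
    have := hF (x + h) x
    rw [add_sub_cancel_left] at this
    gcongr
  · rw [mem_closedBall_zero_iff, not_le] at hx
    have h1 : ‖x‖ ≤ ‖x + h‖ + ‖h‖ := by simpa using norm_sub_le (x + h) h
    rw [hsupp x (by linarith [norm_nonneg h]), hsupp (x + h) (by linarith)]
    simp

variable [InnerProductSpace ℝ E'] (μ : Measure E) [μ.IsAddRightInvariant]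

theorem diffEnergy_add_self {F : E → E'} (hF : Continuous F) (h : E) :
    diffEnergy μ F (h + h) + secondDiffEnergy μ F h = 4 * diffEnergy μ F h := by
  have hm : Measurable fun x => ‖F (x + h) - F x‖ₑ ^ 2 :=
    measurable_enorm_sq_of_continuous (by fun_prop)
  have hm' : Measurable fun x => ‖F (x + h + h) - F (x + h)‖ₑ ^ 2 :=
    measurable_enorm_sq_of_continuous (by fun_prop)
  have ht : ∫⁻ x, ‖F (x + h + h) - F (x + h)‖ₑ ^ 2 ∂μ = diffEnergy μ F h :=
    lintegral_add_right_eq_self (fun x => ‖F (x + h) - F x‖ₑ ^ 2) h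
  have hm'' : Measurable fun x => ‖F (x + (h + h)) - F x‖ₑ ^ 2 :=
    measurable_enorm_sq_of_continuous (by fun_prop)
  rw [diffEnergy, secondDiffEnergy, ← lintegral_add_left hm'']
  have hpt : ∀ x, ‖F (x + (h + h)) - F x‖ₑ ^ 2 +
      ‖F (x + h + h) - F (x + h) - (F (x + h) - F x)‖ₑ ^ 2 =
      2 * ‖F (x + h + h) - F (x + h)‖ₑ ^ 2 + 2 * ‖F (x + h) - F x‖ₑ ^ 2 := fun x => by
    rw [← enorm_add_sq_add_enorm_sub_sq, ← add_assoc]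
    congr 3
    abel
  simp_rw [hpt]
  rw [lintegral_add_left (hm'.const_mul 2), lintegral_const_mul _ hm', lintegral_const_mul _ hm, ht,
    ← diffEnergy, ← add_mul]
  norm_num

theorem sum_secondDiffEnergy_le [NormedSpace ℝ E] {F : E → E'} (hF : Continuous F) (h : E) (N : ℕ) :
    ∑ n ∈ Finset.range N, 4 ^ n * secondDiffEnergy μ F ((1 / 2 : ℝ) ^ (n + 1) • h) ≤
      4 ^ N * diffEnergy μ F ((1 / 2 : ℝ) ^ N • h) := by
  induction N with
  | zero => simp
  | succ N ih =>
    have key := diffEnergy_add_self μ hF ((1 / 2 : ℝ) ^ (N + 1) • h)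
    have h2 : (1 / 2 : ℝ) ^ (N + 1) • h + (1 / 2 : ℝ) ^ (N + 1) • h = (1 / 2 : ℝ) ^ N • h := by
      rw [← add_smul]; congr 1; ring
    rw [h2] at key
    rw [Finset.sum_range_succ, pow_succ (4 : ℝ≥0∞), mul_assoc, ← key, mul_add]
    gcongr

theorem lintegral_mixedDiff_le {F : E → E'} (hF : Continuous F) (h g : E) :
    ∫⁻ x, ‖F (x + (h + h) + (g + g)) - F (x + (h + h)) - F (x + (g + g)) + F x‖ₑ ^ 2 ∂μ ≤
      2 * secondDiffEnergy μ F (h + g) + 2 * secondDiffEnergy μ F (g - h) := by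
  have ht : ∫⁻ x, ‖F (x + (h + h) + (g - h) + (g - h)) - F (x + (h + h) + (g - h)) -
      (F (x + (h + h) + (g - h)) - F (x + (h + h)))‖ₑ ^ 2 ∂μ = secondDiffEnergy μ F (g - h) :=
    lintegral_add_right_eq_self (fun x => ‖F (x + (g - h) + (g - h)) - F (x + (g - h)) -
      (F (x + (g - h)) - F x)‖ₑ ^ 2) (h + h)
  have hm : Measurable fun x => ‖F (x + (h + g) + (h + g)) - F (x + (h + g)) -
      (F (x + (h + g)) - F x)‖ₑ ^ 2 := measurable_enorm_sq_of_continuous (by fun_prop)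
  have hm' : Measurable fun x => ‖F (x + (h + h) + (g - h) + (g - h)) - F (x + (h + h) + (g - h)) -
      (F (x + (h + h) + (g - h)) - F (x + (h + h)))‖ₑ ^ 2 :=
    measurable_enorm_sq_of_continuous (by fun_prop)
  rw [← ht, secondDiffEnergy, ← lintegral_const_mul _ hm, ← lintegral_const_mul _ hm',
    ← lintegral_add_left (hm.const_mul 2)]
  refine lintegral_mono fun x => le_trans (le_of_eq ?_) (enorm_sub_sq_le _ _)
  have e1 : x + (h + g) + (h + g) = x + (h + h) + (g + g) := by abel
  have e2 : x + (h + h) + (g - h) = x + (h + g) := by abel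
  have e3 : x + (h + g) + (g - h) = x + (g + g) := by abel
  simp only [e1, e2, e3]
  congr 2
  abel

end Energy

section Additivity

variable {E E' : Type*} [NormedAddCommGroup E] [NormedAddCommGroup E']

/-- The failure of additivity of the increments of `F` at `x`. -/
def addDefect (F : E → E') (x h g : E) : E' := F (x + h + g) - F (x + h) - F (x + g) + F x

theorem norm_addDefect_sub_le {F : E → E'} {L : ℝ} (hF : ∀ x y, ‖F x - F y‖ ≤ L * ‖x - y‖)
    (x h g h' g' : E) :
    ‖addDefect F x h g - addDefect F x h' g'‖ ≤ 2 * L * (‖h - h'‖ + ‖g - g'‖) := by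
  have hL : 0 ≤ L ∨ ‖h - h'‖ = 0 := by
    by_contra! H
    have := (norm_nonneg _).trans (hF h h')
    have h0 := lt_of_le_of_ne (norm_nonneg _) H.2.symm
    nlinarith
  have hL' : L * ‖h - h' + (g - g')‖ ≤ L * (‖h - h'‖ + ‖g - g'‖) := by
    rcases hL with hL | hL
    · gcongr; exact norm_add_le _ _
    · rw [norm_eq_zero] at hL; simp [hL]
  have e : addDefect F x h g - addDefect F x h' g' =
      (F (x + h + g) - F (x + h' + g')) - (F (x + h) - F (x + h')) -
        (F (x + g) - F (x + g')) := by unfold addDefect; abel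
  have h1 := hF (x + h + g) (x + h' + g')
  have h2 := hF (x + h) (x + h')
  have h3 := hF (x + g) (x + g')
  rw [show x + h + g - (x + h' + g') = h - h' + (g - g') by abel] at h1
  rw [add_sub_add_left_eq_sub] at h2 h3
  rw [e]
  refine (norm_sub_le _ _).trans ((add_le_add_left (norm_sub_le _ _) _).trans ?_)
  linarith

variable [NormedSpace ℝ E] [InnerProductSpace ℝ E'] [MeasurableSpace E] [BorelSpace E]

theorem sum_lintegral_addDefect_le (μ : Measure E) [μ.IsAddRightInvariant] {F : E → E'} {L P : ℝ}
    (hL : 0 ≤ L) (hc : Continuous F) (hF : ∀ x y, ‖F x - F y‖ ≤ L * ‖x - y‖)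
    (hsupp : ∀ x, P < ‖x‖ → F x = 0) {c R : ℝ} (hc0 : 0 ≤ c) {h g : E} (hh : ‖h‖ ≤ R)
    (hg : ‖g‖ ≤ R) (N : ℕ) :
    ∑ n ∈ Finset.range N, 4 ^ n * ∫⁻ x, ‖addDefect F x ((c / 2 ^ n) • h) ((c / 2 ^ n) • g)‖ₑ ^ 2 ∂μ ≤
      4 * (ENNReal.ofReal ((L * (2 * c * R)) ^ 2) * μ (closedBall 0 (P + 2 * c * R))) := by
  have key : ∀ v : E, ‖v‖ ≤ 2 * c * R →
      ∑ n ∈ Finset.range N, 4 ^ n * secondDiffEnergy μ F ((1 / 2 : ℝ) ^ (n + 1) • v) ≤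
      ENNReal.ofReal ((L * (2 * c * R)) ^ 2) * μ (closedBall 0 (P + 2 * c * R)) := fun v hv => by
    have hn : ‖(1 / 2 : ℝ) ^ N • v‖ = (1 / 2 : ℝ) ^ N * ‖v‖ := by
      rw [norm_smul, Real.norm_of_nonneg (by positivity)]
    have h4 : (4 : ℝ≥0∞) ^ N = ENNReal.ofReal (4 ^ N) := by
      rw [ENNReal.ofReal_pow (by norm_num)]; norm_num
    refine (sum_secondDiffEnergy_le μ hc v N).trans ?_
    refine (mul_le_mul_right (diffEnergy_le μ hF hsupp _) _).trans ?_
    rw [← mul_assoc, hn, h4, ← ENNReal.ofReal_mul (by positivity)]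
    have e : (4 : ℝ) ^ N * (L * ((1 / 2 : ℝ) ^ N * ‖v‖)) ^ 2 = (L * ‖v‖) ^ 2 := by
      have : (4 : ℝ) ^ N * ((1 / 2 : ℝ) ^ N) ^ 2 = 1 := by
        rw [← pow_mul, mul_comm N 2, pow_mul, ← mul_pow]; norm_num
      linear_combination (L * ‖v‖) ^ 2 * this
    have hp : (1 / 2 : ℝ) ^ N ≤ 1 := pow_le_one₀ (by norm_num) (by norm_num)
    have : (1 / 2 : ℝ) ^ N * ‖v‖ ≤ 2 * c * R := (mul_le_of_le_one_left (norm_nonneg _) hp).trans hv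
    rw [e]
    gcongr
  have hpt : ∀ n, ∫⁻ x, ‖addDefect F x ((c / 2 ^ n) • h) ((c / 2 ^ n) • g)‖ₑ ^ 2 ∂μ ≤
      2 * secondDiffEnergy μ F ((1 / 2 : ℝ) ^ (n + 1) • c • (h + g)) +
      2 * secondDiffEnergy μ F ((1 / 2 : ℝ) ^ (n + 1) • c • (g - h)) := fun n => by
    have hd : ∀ v : E, (c / 2 ^ n) • v =
        (1 / 2 : ℝ) ^ (n + 1) • c • v + (1 / 2 : ℝ) ^ (n + 1) • c • v := fun v => by
      rw [← add_smul, smul_smul]; congr 1; rw [one_div, inv_pow, pow_succ]; field_simp; norm_num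
    have := lintegral_mixedDiff_le μ hc ((1 / 2 : ℝ) ^ (n + 1) • c • h) ((1 / 2 : ℝ) ^ (n + 1) • c • g)
    rw [← hd, ← hd, ← smul_add, ← smul_add, ← smul_sub, ← smul_sub] at this
    exact this
  have hn1 : ‖c • (h + g)‖ ≤ 2 * c * R := by
    rw [norm_smul, Real.norm_of_nonneg hc0]
    nlinarith [norm_add_le h g]
  have hn2 : ‖c • (g - h)‖ ≤ 2 * c * R := by
    rw [norm_smul, Real.norm_of_nonneg hc0]
    nlinarith [norm_sub_le g h]
  have := add_le_add (mul_le_mul_right (key _ hn1) 2) (mul_le_mul_right (key _ hn2) 2)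
  rw [← add_mul, Finset.mul_sum, Finset.mul_sum, ← Finset.sum_add_distrib] at this
  refine le_trans (Finset.sum_le_sum fun n _ => ?_) (this.trans (le_of_eq (by norm_num)))
  refine (mul_le_mul_right (hpt n) _).trans (le_of_eq ?_)
  ring

theorem exists_almost_additive_scales [FiniteDimensional ℝ E] (μ : Measure E) [μ.IsAddHaarMeasure]
    {L P c R η α : ℝ} (hL : 0 ≤ L) (hc0 : 0 < c) (hη : 0 < η) (hα : 0 < α) :
    ∃ N : ℕ, ∀ F : E → E', (∀ x y, ‖F x - F y‖ ≤ L * ‖x - y‖) → (∀ x, P < ‖x‖ → F x = 0) →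
      ∃ (S : ℕ → Set E) (G : Set E), (∀ n, MeasurableSet (S n)) ∧ MeasurableSet G ∧
        μ G ≤ ENNReal.ofReal α ∧
        (∀ x ∉ G, ∀ n, ∑ i ∈ Finset.range n, (S i).indicator (1 : E → ℕ) x ≤ N) ∧
        ∀ n, ∀ x ∉ S n, ∀ h g, ‖h‖ ≤ R → ‖g‖ ≤ R →
          ‖addDefect F x ((c / 2 ^ n) • h) ((c / 2 ^ n) • g)‖ ≤ η * (c / 2 ^ n) := by
  classical
  set ρ := η / (8 * (L + 1)) with hρ
  have hρ0 : 0 < ρ := by positivity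
  obtain ⟨V, hVR, hVf, hV⟩ := (isCompact_closedBall (0 : E) R).finite_cover_balls hρ0
  lift V to Finset E using hVf
  set Q : ℝ≥0∞ := ENNReal.ofReal ((L * (2 * c * R)) ^ 2) * μ (closedBall 0 (P + 2 * c * R)) with hQ
  have hQt : Q ≠ ⊤ := ENNReal.mul_ne_top ENNReal.ofReal_ne_top measure_closedBall_lt_top.ne
  set C : ℝ≥0∞ := ((V ×ˢ V).card : ℝ≥0∞) * (4 * Q) with hC
  have hCt : C ≠ ⊤ := ENNReal.mul_ne_top (ENNReal.natCast_ne_top _)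
    (ENNReal.mul_ne_top (by norm_num) hQt)
  set M : ℝ≥0∞ := C / ENNReal.ofReal α + 1 with hM
  have hα' : ENNReal.ofReal α ≠ 0 := by simpa using hα
  have hMt : M ≠ ⊤ := ENNReal.add_ne_top.2 ⟨ENNReal.div_ne_top hCt hα', by norm_num⟩
  have hM0 : M ≠ 0 := by simp [hM]
  set t : ℝ≥0∞ := ENNReal.ofReal ((η / 2 * c) ^ 2) with ht
  have ht0 : t ≠ 0 := by simp only [ht, ne_eq, ENNReal.ofReal_eq_zero, not_le]; positivity
  have htt : t ≠ ⊤ := ENNReal.ofReal_ne_top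
  have hMtt : M / t ≠ ⊤ := ENNReal.div_ne_top hMt ht0
  refine ⟨⌈(M / t).toReal⌉₊, fun F hF hsupp => ?_⟩
  have hcont : Continuous F :=
    (LipschitzWith.of_dist_le_mul (K := L.toNNReal) fun x y => by
      simpa [dist_eq_norm, hL] using hF x y).continuous
  set D : ℕ → E → ℝ≥0∞ := fun n x =>
    ∑ p ∈ V ×ˢ V, 4 ^ n * ‖addDefect F x ((c / 2 ^ n) • p.1) ((c / 2 ^ n) • p.2)‖ₑ ^ 2 with hD
  have hAm : ∀ h g, Measurable fun x => ‖addDefect F x h g‖ₑ ^ 2 := fun h g =>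
    measurable_enorm_sq_of_continuous (by unfold addDefect; fun_prop)
  have hDm : ∀ n, Measurable (D n) := fun n =>
    Finset.measurable_sum _ fun p _ => (hAm _ _).const_mul _
  have hDsum : ∫⁻ x, ∑' n, D n x ∂μ ≤ C := by
    rw [lintegral_tsum fun n => (hDm n).aemeasurable]
    refine ENNReal.tsum_le_of_sum_range_le fun N => ?_
    have : ∀ n, ∫⁻ x, D n x ∂μ = ∑ p ∈ V ×ˢ V,
        4 ^ n * ∫⁻ x, ‖addDefect F x ((c / 2 ^ n) • p.1) ((c / 2 ^ n) • p.2)‖ₑ ^ 2 ∂μ := fun n => by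
      simp only [hD]
      rw [lintegral_finsetSum _ fun p _ => (hAm _ _).const_mul _]
      exact Finset.sum_congr rfl fun p _ => lintegral_const_mul _ (hAm _ _)
    simp_rw [this]
    rw [Finset.sum_comm, hC, ← nsmul_eq_mul]
    refine Finset.sum_le_card_nsmul _ _ _ fun p hp => ?_
    rw [Finset.mem_product] at hp
    exact sum_lintegral_addDefect_le μ hL hcont hF hsupp hc0.le
      (mem_closedBall_zero_iff.1 (hVR hp.1)) (mem_closedBall_zero_iff.1 (hVR hp.2)) N
  refine ⟨fun n => {x | t ≤ D n x}, {x | M ≤ ∑' n, D n x},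
    fun n => measurableSet_le measurable_const (hDm n),
    measurableSet_le measurable_const (Measurable.tsum hDm), ?_, ?_, ?_⟩
  · refine (meas_ge_le_lintegral_div (Measurable.tsum hDm).aemeasurable hM0 hMt).trans ?_
    refine ENNReal.div_le_of_le_mul (hDsum.trans ?_)
    rw [hM, mul_add, ENNReal.mul_div_cancel hα' ENNReal.ofReal_ne_top]
    exact le_self_add
  · intro x hx n
    have h1 : (∑ i ∈ Finset.range n, ({x | t ≤ D i x} : Set E).indicator (1 : E → ℕ) x : ℕ) * t ≤ M := by
      rw [mem_ofPred_eq, not_le] at hx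
      refine le_trans ?_ ((ENNReal.sum_le_tsum (Finset.range n)).trans hx.le)
      rw [Nat.cast_sum, Finset.sum_mul]
      refine Finset.sum_le_sum fun i _ => ?_
      by_cases hi : t ≤ D i x <;> simp [indicator, hi]
    have h2 := (ENNReal.le_div_iff_mul_le (Or.inl ht0) (Or.inl htt)).2 h1
    have h3 := ENNReal.toReal_mono hMtt h2
    rw [ENNReal.toReal_natCast] at h3
    exact_mod_cast h3.trans (Nat.le_ceil _)
  · intro n x hx h g hh hg
    set r := c / 2 ^ n with hr
    have hr0 : 0 < r := by positivity
    rw [mem_ofPred_eq, not_le] at hx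
    have hnet : ∀ z, ‖z‖ ≤ R → ∃ v ∈ V, ‖r • z - r • v‖ ≤ r * ρ := fun z hz => by
      obtain ⟨v, hv, hzv⟩ := mem_iUnion₂.1 (hV (mem_closedBall_zero_iff.2 hz))
      refine ⟨v, hv, ?_⟩
      rw [← smul_sub, norm_smul, Real.norm_of_nonneg hr0.le, ← dist_eq_norm]
      exact mul_le_mul_of_nonneg_left (mem_ball.1 hzv).le hr0.le
    obtain ⟨v, hv, hhv⟩ := hnet h hh
    obtain ⟨w, hw, hgw⟩ := hnet g hg
    have h1 : 4 ^ n * ‖addDefect F x (r • v) (r • w)‖ₑ ^ 2 < t :=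
      lt_of_le_of_lt (Finset.single_le_sum
        (f := fun p : E × E => 4 ^ n * ‖addDefect F x (r • p.1) (r • p.2)‖ₑ ^ 2)
        (fun _ _ => zero_le) (Finset.mk_mem_product hv hw)) hx
    have h4 : (4 : ℝ≥0∞) ^ n = ENNReal.ofReal (4 ^ n) := by
      rw [ENNReal.ofReal_pow (by norm_num)]; norm_num
    rw [h4, ← ofReal_norm, ← ENNReal.ofReal_pow (norm_nonneg _),
      ← ENNReal.ofReal_mul (by positivity), ht, ENNReal.ofReal_lt_ofReal_iff (by positivity)] at h1
    have h2 : ‖addDefect F x (r • v) (r • w)‖ ≤ η / 2 * r := by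
      have e : (4 : ℝ) ^ n * ‖addDefect F x (r • v) (r • w)‖ ^ 2 =
          (2 ^ n * ‖addDefect F x (r • v) (r • w)‖) ^ 2 := by
        rw [mul_pow, ← pow_mul, mul_comm n 2, pow_mul]; norm_num
      rw [e] at h1
      have h5 := lt_of_pow_lt_pow_left₀ 2 (by positivity) h1
      rw [hr, ← mul_div_assoc, le_div_iff₀ (by positivity)]
      linarith
    have h3 := norm_addDefect_sub_le hF x (r • h) (r • g) (r • v) (r • w)
    have h5 := norm_sub_norm_le (addDefect F x (r • h) (r • g)) (addDefect F x (r • v) (r • w))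
    have h6 : 2 * L * (‖r • h - r • v‖ + ‖r • g - r • w‖) ≤ 2 * L * (r * ρ + r * ρ) := by gcongr
    have h7 : L * ρ ≤ η / 8 := by
      rw [hρ, ← mul_div_assoc, div_le_div_iff₀ (by positivity) (by norm_num)]
      nlinarith
    nlinarith

end Additivity

section Coloring

theorem exists_coherent_colors {X Γ : Type*} [MeasurableSpace X] [Fintype Γ] [Nonempty Γ]
    (ν : Measure X) [IsFiniteMeasure ν] {S : ℕ → Set X} (hS : ∀ n, MeasurableSet (S n))
    {χ : ℕ → X → Γ} (hχ : ∀ n a, MeasurableSet (χ n ⁻¹' {a})) {N : ℕ}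
    (hN : ∀ᵐ x ∂ν, ∀ n, ∑ i ∈ Finset.range n, (S i).indicator (1 : X → ℕ) x ≤ N) :
    ∃ r : ℕ → Γ, MeasurableSet {x | ∀ n, x ∈ S n → χ n x = r n} ∧
      ν univ ≤ (Fintype.card Γ : ℝ≥0∞) ^ N * ν {x | ∀ n, x ∈ S n → χ n x = r n} := by
  classical
  set K : ℝ≥0∞ := (Fintype.card Γ : ℝ≥0∞) with hK
  have hK1 : 1 ≤ K := by
    rw [hK]; exact_mod_cast Fintype.card_pos
  have hKt : K ≠ ⊤ := ENNReal.natCast_ne_top _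
  set φ : ℕ → Γ → X → ℝ≥0∞ := fun n a x =>
    if x ∈ S n then if x ∈ χ n ⁻¹' {a} then K else 0 else 1 with hφ
  have hφm : ∀ n a, Measurable (φ n a) := fun n a =>
    Measurable.ite (hS n) (Measurable.ite (hχ n a) measurable_const measurable_const)
      measurable_const
  have hφsum : ∀ n x, ∑ a, φ n a x = K := fun n x => by
    by_cases hx : x ∈ S n <;> simp [hφ, hx, hK]
  have step : ∀ n (W : X → ℝ≥0∞), ∃ a, Measurable W →
      ∫⁻ x, W x ∂ν ≤ ∫⁻ x, W x * φ n a x ∂ν := fun n W => by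
    by_cases hW : Measurable W
    · have hsum : K * ∫⁻ x, W x ∂ν = ∑ a, ∫⁻ x, W x * φ n a x ∂ν := by
        rw [← lintegral_finsetSum (f := fun a x => W x * φ n a x) _ fun a _ => hW.mul (hφm n a)]
        simp_rw [← Finset.mul_sum, hφsum]
        rw [lintegral_mul_const _ hW, mul_comm]
      obtain ⟨a, -, ha⟩ := Finset.exists_max_image Finset.univ
        (fun a => ∫⁻ x, W x * φ n a x ∂ν) Finset.univ_nonempty
      refine ⟨a, fun _ => ?_⟩
      rw [← ENNReal.mul_le_mul_iff_right (one_pos.trans_le hK1).ne' hKt, hsum]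
      refine (Finset.sum_le_card_nsmul _ _ _ ha).trans (le_of_eq ?_)
      rw [nsmul_eq_mul, Finset.card_univ]
    · exact ⟨Classical.arbitrary Γ, fun h => absurd h hW⟩
  choose pick hpick using step
  let W : ℕ → X → ℝ≥0∞ := fun n => Nat.rec 1 (fun n W x => W x * φ n (pick n W) x) n
  set r : ℕ → Γ := fun n => pick n (W n) with hr
  have hWs : ∀ n x, W (n + 1) x = W n x * φ n (r n) x := fun n x => rfl
  have hWm : ∀ n, Measurable (W n) := fun n => by
    induction n with
    | zero => exact measurable_one
    | succ n ih => exact ih.mul (hφm n _)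
  have hWint : ∀ n, ν univ ≤ ∫⁻ x, W n x ∂ν := fun n => by
    induction n with
    | zero => simp [W]
    | succ n ih => exact ih.trans (hpick n (W n) (hWm n))
  set B : ℕ → Set X := fun n => {x | ∀ i < n, x ∈ S i → χ i x = r i} with hB
  have hBm : ∀ n, MeasurableSet (B n) := fun n => by
    have : B n = ⋂ i, ⋂ (_ : i < n), ((S i)ᶜ ∪ χ i ⁻¹' {r i}) := by
      ext x; simp [hB, imp_iff_not_or]
    rw [this]
    exact MeasurableSet.iInter fun i => MeasurableSet.iInter fun _ => (hS i).compl.union (hχ i _)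
  have hWB : ∀ n x, W n x ≤ (B n).indicator
      (fun x => K ^ (∑ i ∈ Finset.range n, (S i).indicator (1 : X → ℕ) x)) x := fun n x => by
    induction n with
    | zero => simp [W, hB]
    | succ n ih =>
      rw [hWs]
      by_cases hx : x ∈ B (n + 1)
      · have hx' : x ∈ B n := fun i hi => hx i (hi.trans (Nat.lt_succ_self n))
        rw [indicator_of_mem hx'] at ih
        rw [indicator_of_mem hx, Finset.sum_range_succ, pow_add]
        refine mul_le_mul' ih ?_
        by_cases hxn : x ∈ S n
        · simp only [hφ, hxn, if_true, indicator_of_mem, Pi.one_apply, pow_one]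
          split_ifs <;> simp
        · simp [hφ, hxn]
      · by_cases hx' : x ∈ B n
        · have : x ∈ S n ∧ χ n x ≠ r n := by
            by_contra! H
            exact hx fun i hi hxi => (Nat.lt_succ_iff_lt_or_eq.1 hi).elim (fun h => hx' i h hxi)
              fun h => by subst h; exact H hxi
          simp [hφ, this.1, this.2]
        · rw [indicator_of_notMem hx'] at ih
          simp [nonpos_iff_eq_zero.1 ih]
  have hBn : ∀ n, ν univ ≤ K ^ N * ν (B n) := fun n => by
    refine (hWint n).trans ?_
    rw [← lintegral_indicator_const (hBm n)]
    refine lintegral_mono_ae ?_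
    filter_upwards [hN] with x hx
    refine (hWB n x).trans (indicator_le_indicator' fun _ => ?_)
    exact pow_le_pow_right₀ hK1 (hx n)
  have hBeq : {x | ∀ n, x ∈ S n → χ n x = r n} = ⋂ n, B n := by
    ext x
    simp only [hB, mem_ofPred_eq, mem_iInter]
    exact ⟨fun h n i _ => h i, fun h n => h (n + 1) n (Nat.lt_succ_self n)⟩
  refine ⟨r, ?_, ?_⟩
  · rw [hBeq]; exact MeasurableSet.iInter hBm
  · rw [hBeq]
    have hanti : Antitone B := fun m n hmn x hx i hi => hx i (hi.trans_le hmn)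
    have htend := tendsto_measure_iInter_atTop (fun n => (hBm n).nullMeasurableSet) hanti
      ⟨0, measure_ne_top ν _⟩
    exact ge_of_tendsto' (ENNReal.Tendsto.const_mul htend (Or.inr (ENNReal.pow_ne_top hKt))) hBn

theorem norm_le_card_mul {k : ℕ} {x : EuclideanSpace ℝ (Fin k)} {s : ℝ} (h : ∀ i, |x i| ≤ s) :
    ‖x‖ ≤ k * s := by
  rcases Nat.eq_zero_or_pos k with rfl | hk
  · simp [Subsingleton.elim x 0]
  have hs : 0 ≤ s := (abs_nonneg _).trans (h ⟨0, hk⟩)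
  have hk' : (1 : ℝ) ≤ k := by exact_mod_cast hk
  rw [EuclideanSpace.norm_eq]
  refine Real.sqrt_le_iff.2 ⟨by positivity, ?_⟩
  calc ∑ i, ‖x i‖ ^ 2 ≤ ∑ _i : Fin k, s ^ 2 :=
        Finset.sum_le_sum fun i _ => pow_le_pow_left₀ (norm_nonneg _) (h i) 2
    _ = k * s ^ 2 := by simp
    _ ≤ (k * s) ^ 2 := by rw [mul_pow]; gcongr; nlinarith

/-- The grid cell of side `s` containing `x`, with its position recorded modulo `M`. -/
def gridColor {k : ℕ} (M : ℕ) (s : ℝ) (x : EuclideanSpace ℝ (Fin k)) : Fin k → ZMod M :=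
  fun i => (⌊x i / s⌋ : ZMod M)

theorem measurableSet_gridColor_preimage {k : ℕ} (M : ℕ) (s : ℝ) (a : Fin k → ZMod M) :
    MeasurableSet (gridColor M s ⁻¹' {a}) := by
  have : gridColor M s ⁻¹' {a} = (fun (x : EuclideanSpace ℝ (Fin k)) i => ⌊x i / s⌋) ⁻¹'
      {z | (fun i => (z i : ZMod M)) = a} := rfl
  rw [this]
  refine measurableSet_preimage ?_ (to_countable _).measurableSet
  exact measurable_pi_lambda _ fun i => Int.measurable_floor.comp (by fun_prop)

theorem gridColor_ne {k : ℕ} {r : ℝ} {x y : EuclideanSpace ℝ (Fin k)} (h1 : r / 2 < dist x y)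
    (h2 : dist x y ≤ r) :
    gridColor (2 * k + 2) (r / (2 * k)) x ≠ gridColor (2 * k + 2) (r / (2 * k)) y := by
  intro h
  have hr : 0 < r := by linarith [dist_nonneg (x := x) (y := y)]
  rcases Nat.eq_zero_or_pos k with rfl | hk
  · rw [Subsingleton.elim x y, dist_self] at h1; linarith
  have hk' : (1 : ℝ) ≤ k := by exact_mod_cast hk
  set s := r / (2 * k) with hs
  have hs0 : 0 < s := by positivity
  have hrs : r = 2 * k * s := by rw [hs]; field_simp
  have hcoord : ∀ i, |x i - y i| ≤ dist x y := fun i => by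
    have := PiLp.norm_apply_le (x - y) i
    rwa [PiLp.sub_apply, Real.norm_eq_abs, ← dist_eq_norm] at this
  have hcell : ∀ i, |x i - y i| ≤ s := fun i => by
    have hi := congrFun h i
    simp only [gridColor] at hi
    rw [ZMod.intCast_eq_intCast_iff_dvd_sub] at hi
    have hd : |x i / s - y i / s| ≤ 2 * k := by
      rw [← sub_div, abs_div, abs_of_pos hs0, div_le_iff₀ hs0, ← hrs]
      exact (hcoord i).trans h2
    have hfl : ⌊y i / s⌋ - ⌊x i / s⌋ = 0 := by
      refine Int.eq_zero_of_abs_lt_dvd hi ?_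
      rw [abs_lt] at *
      rw [abs_le] at hd
      have a1 := Int.floor_le (x i / s)
      have a2 := Int.lt_floor_add_one (x i / s)
      have a3 := Int.floor_le (y i / s)
      have a4 := Int.lt_floor_add_one (y i / s)
      constructor
      · have : (-(2 * k + 2 : ℕ) : ℝ) < ((⌊y i / s⌋ - ⌊x i / s⌋ : ℤ) : ℝ) := by
          push_cast; linarith
        exact_mod_cast this
      · have : ((⌊y i / s⌋ - ⌊x i / s⌋ : ℤ) : ℝ) < ((2 * k + 2 : ℕ) : ℝ) := by
          push_cast; linarith
        exact_mod_cast this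
    have := Int.abs_sub_lt_one_of_floor_eq_floor (sub_eq_zero.1 hfl).symm
    rw [← sub_div, abs_div, abs_of_pos hs0, div_lt_one hs0] at this
    exact this.le
  have hdist : dist x y ≤ k * s := by
    rw [dist_eq_norm]
    exact norm_le_card_mul hcell
  linarith

end Coloring

section Content

/-- The Hausdorff content as an outer measure. -/
def contentOuterMeasure (X : Type*) [PseudoEMetricSpace X] (d : ℝ) (hd : 0 < d) : OuterMeasure X :=
  OuterMeasure.ofFunction (fun s => Metric.ediam s ^ d) (by simp [hd])

theorem contentOuterMeasure_apply {X : Type*} [PseudoEMetricSpace X] {d : ℝ} (hd : 0 < d)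
    (s : Set X) : contentOuterMeasure X d hd s = hContent d s := by
  rw [contentOuterMeasure, OuterMeasure.ofFunction_apply]
  rfl

theorem contentOuterMeasure_le_hausdorffMeasure {X : Type*} [EMetricSpace X] [MeasurableSpace X]
    [BorelSpace X] {d : ℝ} (hd : 0 < d) (s : Set X) :
    contentOuterMeasure X d hd s ≤ μH[d] s := by
  rw [Measure.hausdorffMeasure_apply, contentOuterMeasure, OuterMeasure.ofFunction_apply]
  refine le_trans ?_ (le_iSup₂ (1 : ℝ≥0∞) one_pos)
  refine iInf_mono fun t => iInf_mono fun ht => le_iInf fun _ => ENNReal.tsum_le_tsum fun n => ?_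
  rcases (t n).eq_empty_or_nonempty with h | h
  · simp [h, hd]
  · exact le_iSup (fun _ : (t n).Nonempty => Metric.ediam (t n) ^ d) h

theorem outerMeasure_image_le_of_balls {E Y : Type*} [NormedAddCommGroup E] [NormedSpace ℝ E]
    [FiniteDimensional ℝ E] [MeasurableSpace E] [BorelSpace E] (μ : Measure E)
    [μ.IsAddHaarMeasure] (ν : OuterMeasure Y) {F : E → Y} {T : Set E} {P R₀ β : ℝ}
    (hT : T ⊆ closedBall 0 P) (hβ : 0 ≤ β)
    (h : ∀ x ∈ T, ∃ r, 0 < r ∧ r ≤ R₀ ∧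
      ν (F '' closedBall x (5 * r)) ≤ ENNReal.ofReal (β * r ^ Module.finrank ℝ E)) :
    μ (ball 0 1) * ν (F '' T) ≤ ENNReal.ofReal β * μ (closedBall 0 (P + R₀)) := by
  choose! ρ hρ0 hρR hρ using h
  obtain ⟨u, huT, hdisj, hcov⟩ := Vitali.exists_disjoint_subfamily_covering_enlargement_closedBall
    T id ρ R₀ hρR 5 (by norm_num)
  simp only [id] at hdisj hcov
  have hu : u.Countable := by
    refine (hdisj.mono_on fun x _ => ball_subset_closedBall).countable_of_isOpen
      (fun _ _ => isOpen_ball) fun x hx => ⟨x, mem_ball_self (hρ0 x (huT hx))⟩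
  have h1 : ν (F '' T) ≤ ∑' x : u, ν (F '' closedBall (x : E) (5 * ρ x)) := by
    refine le_trans (measure_mono ?_) (measure_biUnion_le ν hu fun x => F '' closedBall x (5 * ρ x))
    rintro _ ⟨x, hx, rfl⟩
    obtain ⟨b, hb, hxb⟩ := hcov x hx
    exact mem_iUnion₂.2 ⟨b, hb, x, hxb (mem_closedBall_self (hρ0 x hx).le), rfl⟩
  have h2 : ∑' x : u, μ (closedBall (x : E) (ρ x)) ≤ μ (closedBall 0 (P + R₀)) := by
    rw [← measure_biUnion hu hdisj fun _ _ => measurableSet_closedBall]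
    refine measure_mono (iUnion₂_subset fun x hx => closedBall_subset_closedBall' ?_)
    have := mem_closedBall.1 (hT (huT hx))
    linarith [hρR x (huT hx)]
  refine (mul_le_mul_right h1 _).trans (le_trans ?_ (mul_le_mul_right h2 _))
  rw [← ENNReal.tsum_mul_left, ← ENNReal.tsum_mul_left]
  refine ENNReal.tsum_le_tsum fun x => ?_
  refine (mul_le_mul_right (hρ x (huT x.2)) _).trans (le_of_eq ?_)
  rw [Measure.addHaar_closedBall μ _ (hρ0 x (huT x.2)).le, ENNReal.ofReal_mul hβ]
  ring

end Content

section Squeezing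

variable {E E' : Type*} [NormedAddCommGroup E] [NormedSpace ℝ E] [NormedAddCommGroup E']

theorem norm_map_nsmul_sub_le {G : E → E'} {a ϱ : ℝ} (h0 : G 0 = 0)
    (hG : ∀ h g, ‖h‖ ≤ ϱ → ‖g‖ ≤ ϱ → ‖G (h + g) - G h - G g‖ ≤ a) {v : E} (j : ℕ)
    (hv : j * ‖v‖ ≤ ϱ) : ‖G (j • v) - j • G v‖ ≤ j * a := by
  induction j with
  | zero => simp [h0]
  | succ j ih =>
    push_cast at hv ⊢
    have hv1 : j * ‖v‖ ≤ ϱ := by linarith [norm_nonneg v]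
    have hv2 : ‖v‖ ≤ ϱ := by nlinarith [norm_nonneg v, (Nat.cast_nonneg j : (0 : ℝ) ≤ j)]
    have h1 := hG (j • v) v (by rwa [← Nat.cast_smul_eq_nsmul ℝ, norm_smul, Real.norm_natCast]) hv2
    have e : G ((j + 1) • v) - (j + 1) • G v =
        (G (j • v + v) - G (j • v) - G v) + (G (j • v) - j • G v) := by
      rw [succ_nsmul, succ_nsmul]; abel
    rw [e]
    refine (norm_add_le _ _).trans ?_
    linarith [ih hv1]

variable [NormedSpace ℝ E']

theorem norm_map_smul_le_of_nonneg {G : E → E'} {a b ϱ l t T : ℝ} {q : ℕ} {w : E} (h0 : G 0 = 0)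
    (hl : ∀ x y, ‖G x - G y‖ ≤ l * ‖x - y‖)
    (hG : ∀ h g, ‖h‖ ≤ ϱ → ‖g‖ ≤ ϱ → ‖G (h + g) - G h - G g‖ ≤ a) (hq : 0 < q) (hl0 : 0 ≤ l)
    (ha : 0 ≤ a) (hw : ‖w‖ ≤ ϱ) (hb : ‖G w‖ ≤ b) (ht : 0 ≤ t) (htT : t ≤ T)
    (htw : t * ‖w‖ ≤ ϱ) : ‖G (t • w)‖ ≤ T * b + 2 * T * q * a + l * ‖w‖ / q := by
  have hq' : (0 : ℝ) < q := by exact_mod_cast hq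
  have hb0 : 0 ≤ b := (norm_nonneg _).trans hb
  set v := (q : ℝ)⁻¹ • w with hv
  have hvn : ‖v‖ = ‖w‖ / q := by
    rw [hv, norm_smul, norm_inv, Real.norm_natCast]; field_simp
  have hqv : q • v = w := by
    rw [← Nat.cast_smul_eq_nsmul ℝ, hv, smul_smul, mul_inv_cancel₀ hq'.ne', one_smul]
  have h1 := norm_map_nsmul_sub_le h0 hG (v := v) q (by rw [hvn]; field_simp; exact hw)
  have hGv : ‖G v‖ ≤ b / q + a := by
    rw [hqv] at h1
    have h2 : ‖q • G v‖ ≤ b + q * a := by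
      have := norm_le_norm_add_norm_sub (G w) (q • G v)
      linarith
    rw [← Nat.cast_smul_eq_nsmul ℝ, norm_smul, Real.norm_natCast] at h2
    rw [div_add' _ _ _ hq'.ne', le_div_iff₀ hq']
    linarith
  set j := ⌊t * q⌋₊ with hj
  have hjle : (j : ℝ) ≤ t * q := Nat.floor_le (by positivity)
  have hjlt : t * q < j + 1 := Nat.lt_floor_add_one _
  have hjv : j * ‖v‖ ≤ ϱ := by
    refine le_trans ?_ htw
    rw [hvn, ← mul_div_assoc, div_le_iff₀ hq']
    nlinarith [norm_nonneg w]
  have h3 := norm_map_nsmul_sub_le h0 hG j hjv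
  have h4 : ‖G (j • v)‖ ≤ j * (b / q + a) + j * a := by
    have h5 := norm_le_norm_add_norm_sub (j • G v) (G (j • v))
    have h6 : ‖j • G v‖ ≤ j * (b / q + a) := by
      rw [← Nat.cast_smul_eq_nsmul ℝ, norm_smul, Real.norm_natCast]
      gcongr
    rw [norm_sub_rev] at h5
    linarith
  have h7 : ‖G (t • w) - G (j • v)‖ ≤ l * ‖w‖ / q := by
    refine (hl _ _).trans ?_
    have e : t • w - j • v = ((t * q - j) / q) • w := by
      rw [← Nat.cast_smul_eq_nsmul ℝ, hv, smul_smul, ← sub_smul]; congr 1; field_simp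
    rw [e, norm_smul, Real.norm_of_nonneg (div_nonneg (by linarith) hq'.le), mul_div_assoc]
    gcongr
    rw [div_mul_eq_mul_div]
    gcongr
    nlinarith [norm_nonneg w]
  have h8 : ‖G (t • w)‖ ≤ ‖G (j • v)‖ + ‖G (t • w) - G (j • v)‖ := by
    have := norm_add_le (G (j • v)) (G (t • w) - G (j • v))
    rwa [add_sub_cancel] at this
  have h9 : (j : ℝ) * (b / q + a) + j * a ≤ T * b + 2 * T * q * a := by
    have e : T * b + 2 * T * q * a = (T * q) * (b / q + a) + (T * q) * a := by field_simp; ring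
    have : (j : ℝ) ≤ T * q := hjle.trans (by gcongr)
    rw [e]
    gcongr
  linarith

theorem norm_map_smul_le {G : E → E'} {a b ϱ l t T : ℝ} {q : ℕ} {w : E} (h0 : G 0 = 0)
    (hl : ∀ x y, ‖G x - G y‖ ≤ l * ‖x - y‖)
    (hG : ∀ h g, ‖h‖ ≤ ϱ → ‖g‖ ≤ ϱ → ‖G (h + g) - G h - G g‖ ≤ a) (hq : 0 < q) (hl0 : 0 ≤ l)
    (ha : 0 ≤ a) (hw : ‖w‖ ≤ ϱ) (hb : ‖G w‖ ≤ b) (htT : |t| ≤ T) (htw : |t| * ‖w‖ ≤ ϱ) :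
    ‖G (t • w)‖ ≤ T * (b + a) + 2 * T * q * a + l * ‖w‖ / q := by
  rcases le_total 0 t with ht | ht
  · rw [abs_of_nonneg ht] at htT htw
    exact norm_map_smul_le_of_nonneg h0 hl hG hq hl0 ha hw (hb.trans (by linarith)) ht htT htw
  · rw [abs_of_nonpos ht] at htT htw
    have hb' : ‖G (-w)‖ ≤ b + a := by
      have h1 := hG w (-w) hw (by rwa [norm_neg])
      rw [add_neg_cancel, h0, zero_sub, ← neg_add', norm_neg, add_comm] at h1
      have h2 := norm_sub_le (G (-w) + G w) (G w)
      rw [add_sub_cancel_right] at h2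
      linarith
    have := norm_map_smul_le_of_nonneg (w := -w) h0 hl hG hq hl0 ha (by rwa [norm_neg]) hb'
      (neg_nonneg.2 ht) htT (by rwa [norm_neg])
    rwa [neg_smul_neg, norm_neg] at this

end Squeezing

section Collapse

theorem exists_norm_le_mul_abs_coord {k : ℕ} (hk : 0 < k) (w : EuclideanSpace ℝ (Fin k)) :
    ∃ i, ‖w‖ ≤ k * |w i| := by
  have : Nonempty (Fin k) := ⟨⟨0, hk⟩⟩
  obtain ⟨i, -, hi⟩ := Finset.exists_max_image Finset.univ (fun i => |w i|) Finset.univ_nonempty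
  exact ⟨i, norm_le_card_mul fun j => hi j (Finset.mem_univ j)⟩

theorem norm_sub_le_of_almost_additive {E E' : Type*} [NormedAddCommGroup E]
    [NormedAddCommGroup E'] {G : E → E'}
    {a l s ϱ τ : ℝ} (hl : ∀ x y, ‖G x - G y‖ ≤ l * ‖x - y‖)
    (hG : ∀ h g, ‖h‖ ≤ ϱ → ‖g‖ ≤ ϱ → ‖G (h + g) - G h - G g‖ ≤ a) (hl0 : 0 ≤ l)
    {u v u' v' : E} (hu : ‖u‖ ≤ ϱ) (hv : ‖v‖ ≤ ϱ) (hu' : ‖u'‖ ≤ ϱ) (hv' : ‖v'‖ ≤ ϱ)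
    (huu : ‖u - u'‖ ≤ s) (hGv : ‖G v‖ ≤ τ) (hGv' : ‖G v'‖ ≤ τ) :
    ‖G (u + v) - G (u' + v')‖ ≤ l * s + 2 * τ + 2 * a := by
  have e : G (u + v) - G (u' + v') = (G (u + v) - G u - G v) - (G (u' + v') - G u' - G v') +
      (G u - G u') + (G v - G v') := by abel
  have h1 := norm_add_le ((G (u + v) - G u - G v) - (G (u' + v') - G u' - G v') + (G u - G u'))
    (G v - G v')
  have h2 := norm_add_le ((G (u + v) - G u - G v) - (G (u' + v') - G u' - G v')) (G u - G u')
  have h3 := norm_sub_le (G (u + v) - G u - G v) (G (u' + v') - G u' - G v')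
  have h4 := norm_sub_le (G v) (G v')
  have h5 : ‖G u - G u'‖ ≤ l * s := (hl u u').trans (by gcongr)
  rw [e]
  linarith [hG u v hu hv, hG u' v' hu' hv']

/-- A map that is almost additive near `x` and almost constant in one direction maps a ball
around `x` to a set of small content. -/
theorem contentOuterMeasure_image_closedBall_le {E' : Type*} [NormedAddCommGroup E']
    [NormedSpace ℝ E'] {k : ℕ} (hk : 0 < k) (hk' : (0 : ℝ) < k) {L r : ℝ}
    (hL : 0 ≤ L) (hr : 0 < r) {q : ℕ} (hq : 0 < q) {F : EuclideanSpace ℝ (Fin k) → E'}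
    (hF : ∀ x y, ‖F x - F y‖ ≤ L * ‖x - y‖) {x w : EuclideanSpace ℝ (Fin k)}
    (hA : ∀ h g, ‖h‖ ≤ 15 * k * r → ‖g‖ ≤ 15 * k * r → ‖addDefect F x h g‖ ≤ r / q ^ 2)
    (hw : r / 2 ≤ ‖w‖) (hw' : ‖w‖ ≤ r) (hFw : ‖F (x + w) - F x‖ ≤ r / q) :
    contentOuterMeasure E' k hk' (F '' closedBall x (5 * r)) ≤
      ENNReal.ofReal ((2 * (30 * k ^ 2 * L + 80 * k + 2 * L + 2)) ^ k / q * r ^ k) := by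
  set Λ : ℝ := 30 * k ^ 2 * L + 80 * k + 2 * L + 2 with hΛ
  have hΛ0 : 0 ≤ Λ := by positivity
  have hk1 : (1 : ℝ) ≤ k := by exact_mod_cast hk
  have hq' : (0 : ℝ) < q := by exact_mod_cast hq
  have hq1 : (1 : ℝ) ≤ q := by exact_mod_cast hq
  set G : EuclideanSpace ℝ (Fin k) → E' := fun z => F (x + z) - F x with hGdef
  have hG0 : G 0 = 0 := by simp [hGdef]
  have hGl : ∀ y z, ‖G y - G z‖ ≤ L * ‖y - z‖ := fun y z => by
    have := hF (x + y) (x + z)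
    rw [add_sub_add_left_eq_sub] at this
    simpa [hGdef] using this
  have hGA : ∀ h g, ‖h‖ ≤ 15 * k * r → ‖g‖ ≤ 15 * k * r →
      ‖G (h + g) - G h - G g‖ ≤ r / q ^ 2 := fun h g hh hg => by
    have e : G (h + g) - G h - G g = addDefect F x h g := by
      simp only [hGdef, addDefect, add_assoc]; abel
    rw [e]; exact hA h g hh hg
  have hrk : r ≤ k * r := le_mul_of_one_le_left hr.le hk1
  obtain ⟨i₀, hi₀⟩ := exists_norm_le_mul_abs_coord hk w
  have hwi : 0 < |w i₀| := by
    by_contra! H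
    nlinarith
  have hwi0 : w i₀ ≠ 0 := abs_pos.1 hwi
  set t : EuclideanSpace ℝ (Fin k) → ℝ := fun y => (y - x) i₀ / w i₀ with ht
  set U : EuclideanSpace ℝ (Fin k) → EuclideanSpace ℝ (Fin k) := fun y => y - x - t y • w with hU
  have hUi : ∀ y, U y i₀ = 0 := fun y => by
    simp only [hU, ht, PiLp.sub_apply, PiLp.smul_apply, smul_eq_mul]
    field_simp
    ring
  have hty : ∀ y ∈ closedBall x (5 * r), |t y| ≤ 10 * k := fun y hy => by
    have h1 : |(y - x) i₀| ≤ 5 * r := by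
      have := PiLp.norm_apply_le (y - x) i₀
      rw [Real.norm_eq_abs] at this
      exact this.trans (by rw [← dist_eq_norm]; exact mem_closedBall.1 hy)
    simp only [ht]
    rw [abs_div, div_le_iff₀ hwi]
    nlinarith
  have htw : ∀ y ∈ closedBall x (5 * r), |t y| * ‖w‖ ≤ 10 * k * r := fun y hy =>
    mul_le_mul (hty y hy) hw' (norm_nonneg _) (by positivity)
  have hUy : ∀ y ∈ closedBall x (5 * r), ‖U y‖ ≤ 15 * k * r := fun y hy => by
    refine (norm_sub_le _ _).trans ?_
    rw [norm_smul, Real.norm_eq_abs, ← dist_eq_norm]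
    linarith [mem_closedBall.1 hy, htw y hy]
  have hGt : ∀ y ∈ closedBall x (5 * r), ‖G (t y • w)‖ ≤ r / q * (40 * k + L) := fun y hy => by
    have h1 := norm_map_smul_le hG0 hGl hGA hq hL (by positivity) (by nlinarith) hFw (hty y hy)
      ((htw y hy).trans (by nlinarith))
    have h2 : r / (q : ℝ) ^ 2 ≤ r / q := by
      gcongr
      nlinarith
    have h3 : 2 * (10 * (k : ℝ)) * q * (r / (q : ℝ) ^ 2) = 20 * k * (r / q) := by field_simp; ring
    have h4 : L * ‖w‖ / q ≤ L * r / q := by gcongr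
    have h5 : L * r / q = L * (r / q) := by ring
    rw [h3] at h1
    nlinarith
  set s : ℝ := 30 * k * r / q with hs
  have hs0 : 0 < s := by positivity
  set cell : ({j : Fin k // j ≠ i₀} → Fin (q + 1)) → Set (EuclideanSpace ℝ (Fin k)) := fun c =>
    {y | y ∈ closedBall x (5 * r) ∧ ∀ j : {j // j ≠ i₀}, ⌊(U y j + 15 * k * r) / s⌋₊ = c j} with hcell
  have hUj : ∀ y ∈ closedBall x (5 * r), ∀ j, |U y j| ≤ 15 * k * r := fun y hy j => by
    have := PiLp.norm_apply_le (U y) j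
    rw [Real.norm_eq_abs] at this
    exact this.trans (hUy y hy)
  have hcov : F '' closedBall x (5 * r) ⊆ ⋃ c, F '' cell c := by
    rintro _ ⟨y, hy, rfl⟩
    have hlt : ∀ j, ⌊(U y j + 15 * k * r) / s⌋₊ < q + 1 := fun j => by
      refine Nat.lt_succ_of_le (Nat.floor_le_of_le ?_)
      rw [div_le_iff₀ hs0, hs, mul_div_cancel₀ _ hq'.ne']
      linarith [(abs_le.1 (hUj y hy j)).2]
    exact mem_iUnion.2 ⟨fun j => ⟨_, hlt j⟩, y, ⟨hy, fun j => rfl⟩, rfl⟩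
  have hdiam : ∀ c, Metric.ediam (F '' cell c) ≤ ENNReal.ofReal (r / q * Λ) := fun c => by
    refine Metric.ediam_le ?_
    rintro _ ⟨y, ⟨hy, hyc⟩, rfl⟩ _ ⟨z, ⟨hz, hzc⟩, rfl⟩
    rw [edist_dist]
    refine ENNReal.ofReal_le_ofReal ?_
    have hcoord : ∀ j, |(U y - U z) j| ≤ s := fun j => by
      by_cases hj : j = i₀
      · rw [hj, PiLp.sub_apply, hUi, hUi, sub_zero, abs_zero]; exact hs0.le
      · have h1 := (hyc ⟨j, hj⟩).trans (hzc ⟨j, hj⟩).symm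
        have hy0 : 0 ≤ (U y j + 15 * k * r) / s :=
          div_nonneg (by linarith [(abs_le.1 (hUj y hy j)).1]) hs0.le
        have hz0 : 0 ≤ (U z j + 15 * k * r) / s :=
          div_nonneg (by linarith [(abs_le.1 (hUj z hz j)).1]) hs0.le
        have a1 := Nat.floor_le hy0
        have a2 := Nat.lt_floor_add_one ((U y j + 15 * k * r) / s)
        have a3 := Nat.floor_le hz0
        have a4 := Nat.lt_floor_add_one ((U z j + 15 * k * r) / s)
        simp only at h1
        rw [h1] at a1 a2
        have h2 : |(U y j + 15 * k * r) / s - (U z j + 15 * k * r) / s| ≤ 1 :=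
          abs_le.2 ⟨by linarith, by linarith⟩
        rw [← sub_div, add_sub_add_right_eq_sub, abs_div, abs_of_pos hs0, div_le_one hs0] at h2
        exact h2
    have h1 := norm_sub_le_of_almost_additive hGl hGA hL (hUy y hy)
      (show ‖t y • w‖ ≤ 15 * k * r by
        rw [norm_smul, Real.norm_eq_abs]; linarith [htw y hy, mul_pos hk' hr]) (hUy z hz)
      (show ‖t z • w‖ ≤ 15 * k * r by
        rw [norm_smul, Real.norm_eq_abs]; linarith [htw z hz, mul_pos hk' hr])
      (norm_le_card_mul hcoord) (hGt y hy) (hGt z hz)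
    have e : ∀ y, U y + t y • w = y - x := fun y => sub_add_cancel _ _
    rw [e, e] at h1
    simp only [hGdef, add_sub_cancel, sub_sub_sub_cancel_right] at h1
    rw [dist_eq_norm]
    refine h1.trans ?_
    have h2 : r / (q : ℝ) ^ 2 ≤ r / q := by
      gcongr
      nlinarith
    have e2 : L * (k * s) = r / q * (30 * k ^ 2 * L) := by rw [hs]; ring
    rw [e2, hΛ]
    linarith
  have hcard : Fintype.card ({j : Fin k // j ≠ i₀} → Fin (q + 1)) = (q + 1) ^ (k - 1) := by
    simp [Fintype.card_subtype_compl]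
  calc contentOuterMeasure E' k hk' (F '' closedBall x (5 * r))
      ≤ ∑ c, contentOuterMeasure E' k hk' (F '' cell c) :=
        (measure_mono hcov).trans (measure_iUnion_fintype_le _ _)
    _ ≤ ∑ _c : ({j : Fin k // j ≠ i₀} → Fin (q + 1)), ENNReal.ofReal ((r / q * Λ) ^ k) := by
        refine Finset.sum_le_sum fun c _ => (OuterMeasure.ofFunction_le _).trans ?_
        rw [ENNReal.rpow_natCast, ENNReal.ofReal_pow (by positivity)]
        exact pow_le_pow_left₀ zero_le (hdiam c) k
    _ = ENNReal.ofReal ((q + 1) ^ (k - 1) * (r / q * Λ) ^ k) := by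
        rw [Finset.sum_const, Finset.card_univ, hcard, nsmul_eq_mul,
          ENNReal.ofReal_mul (by positivity), ENNReal.ofReal_pow (p := (q : ℝ) + 1) (by positivity)]
        congr 1
        rw [ENNReal.ofReal_add (by positivity) (by norm_num)]
        simp
    _ ≤ ENNReal.ofReal ((2 * Λ) ^ k / q * r ^ k) := by
        refine ENNReal.ofReal_le_ofReal ?_
        have h1 : ((q : ℝ) + 1) ^ (k - 1) * q ≤ (2 * q) ^ k := by
          calc ((q : ℝ) + 1) ^ (k - 1) * q ≤ (2 * q) ^ (k - 1) * (2 * q) := by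
                gcongr <;> linarith
            _ = (2 * q) ^ k := by rw [← pow_succ, Nat.sub_add_cancel hk]
        have e1 : ((q : ℝ) + 1) ^ (k - 1) * (r / q * Λ) ^ k =
            (((q : ℝ) + 1) ^ (k - 1) * q) * ((r * Λ) ^ k / (q ^ k * q)) := by
          rw [div_mul_eq_mul_div, div_pow]; field_simp
        have e2 : (2 * Λ) ^ k / q * r ^ k = (2 * q) ^ k * ((r * Λ) ^ k / (q ^ k * q)) := by
          rw [mul_pow, mul_pow, mul_pow]; field_simp
        rw [e1, e2]
        gcongr

end Collapse

theorem exists_lipschitz_extension_of_unitCube {k : ℕ} {E' : Type*} [NormedAddCommGroup E']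
    [NormedSpace ℝ E'] [FiniteDimensional ℝ E'] {K : ℝ≥0} {A : Set (EuclideanSpace ℝ (Fin k))}
    (hA : A ⊆ unitCube k) {F : EuclideanSpace ℝ (Fin k) → E'} (hF : LipschitzOnWith K F A) :
    ∃ (g : EuclideanSpace ℝ (Fin k) → E') (b : E'),
      (∀ x y, ‖g x - g y‖ ≤ (lipschitzExtensionConstant E' * K : ℝ≥0) * ‖x - y‖) ∧
      (∀ x, 2 * k < ‖x‖ → g x = 0) ∧ ∀ x ∈ A, g x + b = F x := by
  classical
  rcases A.eq_empty_or_nonempty with rfl | ⟨x₀, hx₀⟩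
  · exact ⟨0, 0, fun x y => by simp; positivity, fun _ _ => rfl, fun x hx => hx.elim⟩
  have hnorm : ∀ x ∈ A, ‖x‖ ≤ k := fun x hx => by
    simpa using norm_le_card_mul (x := x) (s := 1) fun i =>
      abs_le.2 ⟨by linarith [(hA hx i).1], (hA hx i).2⟩
  have hdist : ∀ x ∈ A, ‖x - x₀‖ ≤ k := fun x hx => by
    simpa using norm_le_card_mul (x := x - x₀) (s := 1) fun i => by
      rw [PiLp.sub_apply]
      exact abs_le.2 ⟨by linarith [(hA hx i).1, (hA hx₀ i).2],
        by linarith [(hA hx i).2, (hA hx₀ i).1]⟩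
  set f : EuclideanSpace ℝ (Fin k) → E' := fun x => if x ∈ A then F x - F x₀ else 0 with hf
  have hcross : ∀ x ∈ A, ∀ y, 2 * (k : ℝ) < ‖y‖ → ‖F x - F x₀‖ ≤ K * ‖x - y‖ := fun x hx y hy => by
    have h1 := hF.dist_le_mul x hx x₀ hx₀
    rw [dist_eq_norm, dist_eq_norm] at h1
    have h2 := norm_sub_norm_le y x
    rw [norm_sub_rev] at h2
    refine h1.trans (mul_le_mul_of_nonneg_left ?_ K.2)
    linarith [hnorm x hx, hdist x hx]
  have hfar : ∀ y : EuclideanSpace ℝ (Fin k), 2 * (k : ℝ) < ‖y‖ → y ∉ A := fun y hy hyA => by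
    linarith [hnorm y hyA, (Nat.cast_nonneg k : (0 : ℝ) ≤ k)]
  have hlip : LipschitzOnWith K f (A ∪ {y | 2 * (k : ℝ) < ‖y‖}) := by
    refine LipschitzOnWith.of_dist_le_mul fun x hx y hy => ?_
    rw [dist_eq_norm, dist_eq_norm]
    rcases hx with hx | hx <;> rcases hy with hy | hy
    · simpa [hf, hx, hy, dist_eq_norm] using hF.dist_le_mul x hx y hy
    · simpa [hf, hx, hfar y hy] using hcross x hx y hy
    · have := hcross y hy x hx
      rw [norm_sub_rev y x] at this
      simpa [hf, hy, hfar x hx, norm_sub_rev (F x₀)] using this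
    · simp only [hf, hfar x hx, hfar y hy, if_false, sub_zero, norm_zero]
      positivity
  obtain ⟨g, hg, hgf⟩ := hlip.extend_finite_dimension
  refine ⟨g, F x₀, fun x y => ?_, fun x hx => ?_, fun x hx => ?_⟩
  · simpa [dist_eq_norm] using hg.dist_le_mul x y
  · rw [← hgf (Or.inr hx)]
    simp [hf, hfar x hx]
  · rw [← hgf (Or.inl hx)]
    simp [hf, hx]

/-- quantitative biLipschitz piece. For all `k, m ≥ 1`, `L > 0`, `κ > 0`
there exist `c > 0` and `L' ≥ 1` depending only on the data such that: for every `A ⊆ [0,1]^k`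
and every `L`-Lipschitz `F : A → ℝ^m` with `h^k(F(A)) ≥ κ`, there is `B ⊆ A` with
`H^k(B) ≥ c` on which `F` is biLipschitz with constant `L'`. -/
theorem statement5 (k m : ℕ) (hk : 0 < k) (hm : 0 < m) (L κ : ℝ) (hL : 0 < L) (hκ : 0 < κ) :
    ∃ (c L' : ℝ), 0 < c ∧ 1 ≤ L' ∧
      ∀ (A : Set (EuclideanSpace ℝ (Fin k))), A ⊆ unitCube k →
      ∀ F : EuclideanSpace ℝ (Fin k) → EuclideanSpace ℝ (Fin m),
        LipschitzOnWith L.toNNReal F A →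
        ENNReal.ofReal κ ≤ hContent k (F '' A) →
        ∃ B : Set (EuclideanSpace ℝ (Fin k)), B ⊆ A ∧
          ENNReal.ofReal c ≤ μH[k] B ∧ BiLipschitzWithOn L' F B := by
  set Λ : ℝ≥0 := lipschitzExtensionConstant (EuclideanSpace ℝ (Fin m)) * L.toNNReal with hΛ
  set μ : Measure (EuclideanSpace ℝ (Fin k)) := μH[k] with hμ
  have hfin : Module.finrank ℝ (EuclideanSpace ℝ (Fin k)) = k := finrank_euclideanSpace_fin
  have : μ.IsAddHaarMeasure := by
    have h : (μH[(Module.finrank ℝ (EuclideanSpace ℝ (Fin k)) : ℕ)] :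
        Measure (EuclideanSpace ℝ (Fin k))).IsAddHaarMeasure := inferInstance
    rwa [hfin] at h
  have hk' : (0 : ℝ) < k := by exact_mod_cast hk
  set ν := contentOuterMeasure (EuclideanSpace ℝ (Fin m)) k hk' with hν
  set C : ℝ := (2 * (30 * k ^ 2 * Λ + 80 * k + 2 * Λ + 2)) ^ k with hC
  set V : ℝ := (μ (closedBall 0 (k + k))).toReal with hV
  set v : ℝ := (μ (ball 0 1)).toReal with hv
  have hVt : μ (closedBall 0 (k + k)) ≠ ⊤ := measure_closedBall_lt_top.ne
  have hvt : μ (ball 0 1) ≠ ⊤ := measure_ball_lt_top.ne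
  have hv0 : 0 < v := ENNReal.toReal_pos (measure_ball_pos μ 0 one_pos).ne' hvt
  obtain ⟨q₀, hq₀⟩ := exists_nat_gt (C * V / (v * (κ / 4)))
  set q := q₀ + 1 with hq
  have hq0 : 0 < q := Nat.succ_pos _
  have hq' : (0 : ℝ) < q := by exact_mod_cast hq0
  have hqV : C / q * V ≤ v * (κ / 4) := by
    rw [div_lt_iff₀ (by positivity)] at hq₀
    rw [div_mul_eq_mul_div, div_le_iff₀ hq', hq]
    push_cast
    nlinarith [mul_pos hv0 hκ]
  set α : ℝ := κ / (4 * ((Λ : ℝ) ^ k + 1)) with hα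
  have hα0 : 0 < α := by positivity
  obtain ⟨N, hN⟩ := exists_almost_additive_scales (E := EuclideanSpace ℝ (Fin k))
    (E' := EuclideanSpace ℝ (Fin m)) μ (L := Λ) (P := 2 * k) (c := k) (R := 15 * k)
    (η := 1 / q ^ 2) (α := α) Λ.2 hk' (by positivity) hα0
  set Γ := Fin k → ZMod (2 * k + 2) with hΓ
  have hΓ0 : (0 : ℝ) < Fintype.card Γ := by exact_mod_cast Fintype.card_pos
  refine ⟨κ / (2 * ((Λ : ℝ) ^ k + 1)) / Fintype.card Γ ^ N, max q L, by positivity,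
    le_max_of_le_left (by exact_mod_cast hq0), fun A hA F hF hκF => ?_⟩
  obtain ⟨g, b, hgL, hgs, hgF⟩ := exists_lipschitz_extension_of_unitCube hA hF
  rw [← hΛ] at hgL
  obtain ⟨S, G, hSm, hGm, hGα, hSN, hgood⟩ := hN g hgL hgs
  set f : EuclideanSpace ℝ (Fin k) → EuclideanSpace ℝ (Fin m) := fun x => g x + b with hf
  have hfL : ∀ x y, ‖f x - f y‖ ≤ Λ * ‖x - y‖ := fun x y => by
    simpa [hf] using hgL x y
  have hflip : LipschitzWith Λ f := LipschitzWith.of_dist_le_mul fun x y => by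
    simpa [dist_eq_norm] using hfL x y
  have hfdef : ∀ x h h', addDefect f x h h' = addDefect g x h h' := fun x h h' => by
    simp only [hf, addDefect]; abel
  have hfA : f '' A = F '' A := image_congr hgF
  have hnorm : A ⊆ closedBall 0 (k : ℝ) := fun x hx => by
    rw [mem_closedBall_zero_iff]
    simpa using norm_le_card_mul (x := x) (s := 1) fun i =>
      abs_le.2 ⟨by linarith [(hA hx i).1], (hA hx i).2⟩
  set T : Set (EuclideanSpace ℝ (Fin k)) := {x | x ∈ A ∧ ∃ n, x ∉ S n ∧ ∃ w,
    (k / 2 ^ n : ℝ) / 2 ≤ ‖w‖ ∧ ‖w‖ ≤ k / 2 ^ n ∧ ‖f (x + w) - f x‖ ≤ (k / 2 ^ n : ℝ) / q} with hT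
  have hνT : ν (f '' T) ≤ ENNReal.ofReal (κ / 4) := by
    have h := outerMeasure_image_le_of_balls μ ν (F := f) (T := T) (P := k) (R₀ := k) (β := C / q)
      (fun x hx => hnorm hx.1) (by positivity) fun x hx => by
        obtain ⟨-, n, hxS, w, hw, hw', hfw⟩ := hx
        have hr : (0 : ℝ) < k / 2 ^ n := by positivity
        refine ⟨k / 2 ^ n, hr, div_le_self hk'.le (one_le_pow₀ (by norm_num)), ?_⟩
        rw [hfin]
        refine contentOuterMeasure_image_closedBall_le hk hk' Λ.2 hr hq0 hfL
          (fun h h' hh hh' => ?_) hw hw' hfw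
        have hsc : ∀ z : EuclideanSpace ℝ (Fin k), ‖z‖ ≤ 15 * k * (k / 2 ^ n) →
            ‖((k / 2 ^ n : ℝ))⁻¹ • z‖ ≤ 15 * k := fun z hz => by
          rw [norm_smul, norm_inv, Real.norm_of_nonneg hr.le, inv_mul_le_iff₀ hr]
          linarith
        have := hgood n x hxS _ _ (hsc h hh) (hsc h' hh')
        rw [smul_inv_smul₀ hr.ne', smul_inv_smul₀ hr.ne', ← hfdef] at this
        exact this.trans (le_of_eq (by ring))
    rw [← ENNReal.ofReal_toReal hVt, ← ENNReal.ofReal_toReal hvt, ← hV, ← hv,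
      ← ENNReal.ofReal_mul (by positivity)] at h
    have h' := h.trans (ENNReal.ofReal_le_ofReal hqV)
    rw [ENNReal.ofReal_mul hv0.le] at h'
    exact (ENNReal.mul_le_mul_iff_right (by simpa using hv0) ENNReal.ofReal_ne_top).1 h'
  have hν_le : ∀ s, ν (f '' s) ≤ (Λ : ℝ≥0∞) ^ k * μ s := fun s => by
    refine (contentOuterMeasure_le_hausdorffMeasure hk' _).trans ?_
    have := (hflip.lipschitzOnWith (s := s)).hausdorffMeasure_image_le (d := k) hk'.le
    rwa [ENNReal.rpow_natCast] at this
  have hΛe : (Λ : ℝ≥0∞) ^ k ≤ ENNReal.ofReal ((Λ : ℝ) ^ k + 1) := by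
    rw [← ENNReal.ofReal_coe_nnreal, ← ENNReal.ofReal_pow Λ.coe_nonneg]
    exact ENNReal.ofReal_le_ofReal (by linarith)
  have hνG : ν (f '' G) ≤ ENNReal.ofReal (κ / 4) := by
    refine (hν_le G).trans ((mul_le_mul' hΛe hGα).trans (le_of_eq ?_))
    rw [← ENNReal.ofReal_mul (by positivity), hα]
    congr 1
    field_simp
  set A' := A \ (G ∪ T) with hA'
  have hμA' : ENNReal.ofReal (κ / (2 * ((Λ : ℝ) ^ k + 1))) ≤ μ A' := by
    have hsub : f '' A ⊆ f '' A' ∪ (f '' G ∪ f '' T) := by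
      rw [← image_union, ← image_union]
      exact image_mono fun x hx => by
        by_cases h : x ∈ G ∪ T
        exacts [Or.inr h, Or.inl ⟨hx, h⟩]
    have h1 : ENNReal.ofReal κ ≤ ν (f '' A') + ENNReal.ofReal (κ / 2) := by
      refine (hκF.trans (le_of_eq ?_)).trans ((measure_mono hsub).trans ((measure_union_le _ _).trans
        (add_le_add le_rfl ((measure_union_le _ _).trans ((add_le_add hνG hνT).trans
          (le_of_eq ?_))))))
      · rw [hfA, hν, contentOuterMeasure_apply]
      · rw [← ENNReal.ofReal_add (by positivity) (by positivity)]
        congr 1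
        ring
    have h2 : ENNReal.ofReal (κ / 2) ≤ ν (f '' A') := by
      rw [← add_halves κ, ENNReal.ofReal_add (by positivity) (by positivity), add_halves] at h1
      exact ENNReal.le_of_add_le_add_right ENNReal.ofReal_ne_top h1
    have h3 := h2.trans ((hν_le A').trans (mul_le_mul_left hΛe _))
    rw [show κ / 2 = ((Λ : ℝ) ^ k + 1) * (κ / (2 * ((Λ : ℝ) ^ k + 1))) by field_simp,
      ENNReal.ofReal_mul (by positivity)] at h3
    exact (ENNReal.mul_le_mul_iff_right (by simp only [ne_eq, ENNReal.ofReal_eq_zero, not_le]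
                                            positivity) ENNReal.ofReal_ne_top).1 h3
  have : IsFiniteMeasure (μ.restrict A') := ⟨by
    rw [Measure.restrict_apply_univ]
    exact (measure_mono (sdiff_subset.trans hnorm)).trans_lt measure_closedBall_lt_top⟩
  set χ : ℕ → EuclideanSpace ℝ (Fin k) → Γ := fun n =>
    gridColor (2 * k + 2) ((k / 2 ^ n : ℝ) / (2 * k)) with hχ
  obtain ⟨r, hrm, hr⟩ := exists_coherent_colors (μ.restrict A') hSm (χ := χ) (N := N)
    (fun n a => measurableSet_gridColor_preimage _ _ a) (by
      have : ∀ᵐ x ∂μ.restrict A', x ∉ G := by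
        rw [ae_iff]
        simp only [not_not]
        rw [show {x | x ∈ G} = G from rfl, Measure.restrict_apply hGm,
          show G ∩ A' = ∅ from eq_empty_of_forall_notMem fun x hx => hx.2.2 (Or.inl hx.1),
          measure_empty]
      filter_upwards [this] with x hx using hSN x hx)
  rw [Measure.restrict_apply_univ, Measure.restrict_apply hrm] at hr
  set Z := {x | ∀ n, x ∈ S n → χ n x = r n} with hZ
  refine ⟨Z ∩ A', fun x hx => hx.2.1, ?_, fun x hx y hy => ⟨?_, ?_⟩⟩
  · have h1 := hμA'.trans hr
    rw [ENNReal.ofReal_div_of_pos (by positivity)]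
    refine ENNReal.div_le_of_le_mul' (h1.trans (le_of_eq ?_))
    rw [ENNReal.ofReal_pow (by positivity), ENNReal.ofReal_natCast]
  · rcases eq_or_ne x y with rfl | hxy
    · simp
    have hd0 : 0 < dist x y := dist_pos.2 hxy
    have hdk : dist x y ≤ k := by
      rw [dist_eq_norm]
      simpa using norm_le_card_mul (x := x - y) (s := 1) fun i => by
        have h1 := hA hx.2.1 i
        have h2 := hA hy.2.1 i
        rw [PiLp.sub_apply]
        exact abs_le.2 ⟨by linarith [h1.1, h2.2], by linarith [h1.2, h2.1]⟩
    obtain ⟨n, hn1, hn2⟩ := exists_nat_pow_near_of_lt_one (x := dist x y / k) (y := (1 / 2 : ℝ))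
      (by positivity) ((div_le_one hk').2 hdk) (by norm_num) (by norm_num)
    have hd1 : (k / 2 ^ n : ℝ) / 2 < dist x y := by
      rw [lt_div_iff₀ hk'] at hn1
      refine lt_of_eq_of_lt ?_ hn1
      rw [one_div, inv_pow, pow_succ]
      field_simp
    have hd2 : dist x y ≤ k / 2 ^ n := by
      rw [div_le_iff₀ hk'] at hn2
      refine hn2.trans_eq ?_
      rw [one_div, inv_pow]
      field_simp
    have key : ∀ x ∈ A', ∀ y ∈ A', x ∉ S n → (k / 2 ^ n : ℝ) / 2 < dist x y →
        dist x y ≤ k / 2 ^ n → (k / 2 ^ n : ℝ) / q ≤ dist (F x) (F y) := by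
      intro x hx y hy hxS h1 h2
      by_contra! H
      refine hx.2 (Or.inr ⟨hx.1, n, hxS, y - x, ?_, ?_, ?_⟩)
      · rw [← dist_eq_norm, dist_comm]; exact h1.le
      · rw [← dist_eq_norm, dist_comm]; exact h2
      · rw [add_sub_cancel, ← dist_eq_norm, dist_comm]
        simp only [hf]
        rw [hgF x hx.1, hgF y hy.1]
        exact H.le
    have hlow : (k / 2 ^ n : ℝ) / q ≤ dist (F x) (F y) := by
      by_cases hxS : x ∈ S n
      · by_cases hyS : y ∈ S n
        · exact absurd ((hx.1 n hxS).trans (hy.1 n hyS).symm) (gridColor_ne hd1 hd2)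
        · rw [dist_comm] at hd1 hd2 ⊢
          exact key y hy.2 x hx.2 hyS hd1 hd2
      · exact key x hx.2 y hy.2 hxS hd1 hd2
    refine le_trans ?_ hlow
    rw [inv_mul_eq_div]
    gcongr
    exact le_max_left _ _
  · refine (hF.dist_le_mul x hx.2.1 y hy.2.1).trans ?_
    rw [Real.coe_toNNReal _ hL.le]
    gcongr
    exact le_max_right _ _
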